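/- Lemma 2 (Levenshtein supremum): Let N ≥ 1 be an integer and j the first positive zero of J_N. Let f : ℝ^{2N} → ℝ be the Levenshtein function and f̂ its Fourier transform. Then for every d with 0 < d ≤ d₊, where d₊ = (16·N!·|J_{N−1}(j)| / (3·√π·Γ((2N−1)/2)·j^{N−2}))^{1/6}, and every v ∈ ℝ^{2N} with ‖v‖ ≤ d, one has f(v/d)·f̂(0) ≤ f(0)·f̂(d·v); that is, the supremum of f(x/d)/f̂(d x) over x ∈ [0,d] equals f(0)/f̂(0). -/

import Mathlib

open MeasureTheory Real
open scoped RealInnerProductSpace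

/-- The Bessel function of the first kind of integer order `ν`, defined by its
everywhere-convergent power series. -/
noncomputable def besselJ (ν : ℕ) (x : ℝ) : ℝ :=
  ∑' k : ℕ, (-1 : ℝ) ^ k / ((k.factorial : ℝ) * ((k + ν).factorial : ℝ)) * (x / 2) ^ (ν + 2 * k)

/-- `ψ(t) = ∑_{k} (−1)^k t^{2k}/(2^{N+2k}·k!·(N+k)!)`, so that `ψ(t) = J_N(t)/t^N` for `t > 0`. -/
noncomputable def besselPsi (N : ℕ) (t : ℝ) : ℝ :=
  ∑' k : ℕ, (-1 : ℝ) ^ k * t ^ (2 * k) /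
    (2 ^ (N + 2 * k) * (k.factorial : ℝ) * ((N + k).factorial : ℝ))

/-- The Levenshtein function on `ℝ^{2N}`:
`f(x) = N!²·4^N·ψ(j‖x‖)²/(1−‖x‖²)` for `‖x‖ ≠ 1`, and `f(x) = 0` for `‖x‖ = 1`. -/
noncomputable def levenshteinF (N : ℕ) (j : ℝ) (x : EuclideanSpace ℝ (Fin (2 * N))) : ℝ :=
  if ‖x‖ = 1 then 0
  else ((N.factorial : ℝ)) ^ 2 * 4 ^ N * besselPsi N (j * ‖x‖) ^ 2 / (1 - ‖x‖ ^ 2)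

/-- The Fourier transform of an even integrable function `h : ℝ^{2N} → ℝ`,
`ĥ(y) = (2π)^{-N} ∫ cos⟨y,x⟩ h(x) dx`. -/
noncomputable def fourierCos (N : ℕ) (h : EuclideanSpace ℝ (Fin (2 * N)) → ℝ)
    (y : EuclideanSpace ℝ (Fin (2 * N))) : ℝ :=
  (1 / (2 * π) ^ N) * ∫ x : EuclideanSpace ℝ (Fin (2 * N)), Real.cos ⟪y, x⟫ * h x

/-! ### The normalized Bessel functions -/

lemma summable_besselPsi (N : ℕ) (t : ℝ) : Summable fun k : ℕ =>
    (-1 : ℝ) ^ k * t ^ (2 * k) / (2 ^ (N + 2 * k) * (k.factorial : ℝ) * ((N + k).factorial : ℝ)) := by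
  refine Summable.of_norm_bounded (Real.summable_pow_div_factorial (t ^ 2)) fun k => ?_
  rw [norm_div, norm_mul, norm_pow, norm_neg, norm_one, one_pow, one_mul, pow_mul, norm_pow,
    Real.norm_of_nonneg (sq_nonneg t), Real.norm_of_nonneg (by positivity)]
  refine div_le_div_of_nonneg_left (by positivity) (by positivity) ?_
  have h1 : (1 : ℝ) ≤ 2 ^ (N + 2 * k) := one_le_pow₀ (by norm_num)
  have h2 : (1 : ℝ) ≤ ((N + k).factorial : ℝ) := by exact_mod_cast (N + k).factorial_pos
  have h3 : (0 : ℝ) < k.factorial := by positivity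
  calc (k.factorial : ℝ) = 1 * k.factorial * 1 := by ring
    _ ≤ _ := by gcongr

lemma besselPsi_zero (N : ℕ) : besselPsi N 0 = 1 / (2 ^ N * (N.factorial : ℝ)) := by
  rw [besselPsi, tsum_eq_single 0]
  · simp
  · intro k hk
    simp [hk]

lemma besselJ_eq_pow_mul_besselPsi (N : ℕ) (t : ℝ) : besselJ N t = t ^ N * besselPsi N t := by
  rw [besselJ, besselPsi, ← tsum_mul_left]
  refine tsum_congr fun k => ?_
  rw [div_pow, pow_add t, add_comm k N]
  field_simp

lemma hasDerivAt_besselPsi (N : ℕ) (t : ℝ) :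
    HasDerivAt (besselPsi N) (-t * besselPsi (N + 1) t) t := by
  obtain ⟨R, hR⟩ : ∃ R : ℝ, R = |t| + 1 := ⟨_, rfl⟩
  have hRpos : 0 < R := by rw [hR]; positivity
  let c : ℕ → ℝ := fun k => 2 ^ (N + 2 * k) * (k.factorial : ℝ) * ((N + k).factorial : ℝ)
  have hc : ∀ k, (k.factorial : ℝ) ≤ c k := fun k => by
    have h1 : (1 : ℝ) ≤ 2 ^ (N + 2 * k) := one_le_pow₀ (by norm_num)
    have h2 : (1 : ℝ) ≤ ((N + k).factorial : ℝ) := by exact_mod_cast (N + k).factorial_pos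
    have h3 : (0 : ℝ) < k.factorial := by positivity
    calc (k.factorial : ℝ) = 1 * k.factorial * 1 := by ring
      _ ≤ 2 ^ (N + 2 * k) * (k.factorial : ℝ) * ((N + k).factorial : ℝ) := by gcongr
  let g' : ℕ → ℝ → ℝ := fun k y => (-1 : ℝ) ^ k * ((2 * k : ℕ) * y ^ (2 * k - 1)) / c k
  let u : ℕ → ℝ := fun k => (2 * k : ℕ) * R ^ (2 * k - 1) / (k.factorial : ℝ)
  have hu : Summable u := by
    rw [← summable_nat_add_iff 1]
    refine ((Real.summable_pow_div_factorial (R ^ 2)).mul_left (2 * R)).congr fun k => ?_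
    simp only [u, Nat.factorial_succ]
    rw [show 2 * (k + 1) - 1 = 2 * k + 1 by omega]
    push_cast
    field_simp
    ring
  have hder := hasDerivAt_tsum_of_isPreconnected (t := Metric.ball (0 : ℝ) R)
    (g := fun k y => (-1 : ℝ) ^ k * y ^ (2 * k) / c k) (g' := g') (y₀ := 0) (y := t) hu
    Metric.isOpen_ball (convex_ball _ _).isPreconnected
    (fun k y _ => ((hasDerivAt_pow (2 * k) y).const_mul _).div_const _) (fun k y hy => ?_)
    (Metric.mem_ball_self hRpos) (summable_besselPsi N 0) (by simp [hR])
  · convert! hder using 1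
    have hs : Summable fun k => g' k t := by
      refine Summable.of_norm_bounded hu fun k => ?_
      simp only [g', u]
      rw [norm_div, norm_mul, norm_mul, norm_pow, norm_neg, norm_one, one_pow, one_mul, norm_pow,
        Real.norm_natCast, Real.norm_of_nonneg (by positivity : 0 ≤ c k)]
      gcongr
      · simp [hR]
      · exact hc k
    rw [hs.tsum_eq_zero_add, besselPsi, ← tsum_mul_left]
    have h0 : g' 0 t = 0 := by simp [g']
    rw [h0, zero_add]
    refine tsum_congr fun k => ?_
    simp only [g', c]
    rw [show 2 * (k + 1) - 1 = 2 * k + 1 by omega, show N + (k + 1) = N + 1 + k by omega,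
      show N + 2 * (k + 1) = N + 1 + 2 * k + 1 by omega, Nat.factorial_succ k]
    push_cast
    field_simp
    ring
  · simp only [g', u]
    rw [norm_div, norm_mul, norm_mul, norm_pow, norm_neg, norm_one, one_pow, one_mul, norm_pow,
      Real.norm_natCast, Real.norm_of_nonneg (by positivity : 0 ≤ c k)]
    have hy' : ‖y‖ ≤ R := by simpa using (mem_ball_zero_iff.mp hy).le
    gcongr
    exact hc k

lemma continuous_besselPsi (N : ℕ) : Continuous (besselPsi N) :=
  continuous_iff_continuousAt.mpr fun t => (hasDerivAt_besselPsi N t).continuousAt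

lemma besselPsi_recurrence (N : ℕ) (t : ℝ) :
    besselPsi N t + t ^ 2 * besselPsi (N + 2) t = 2 * (N + 1) * besselPsi (N + 1) t := by
  have h0 := (summable_besselPsi N t).tsum_eq_zero_add
  have h1 := (summable_besselPsi (N + 1) t).tsum_eq_zero_add
  have hs0 := (summable_nat_add_iff 1).mpr (summable_besselPsi N t)
  have hs2 := (summable_besselPsi (N + 2) t).mul_left (t ^ 2)
  have e : ∑' k : ℕ, ((-1 : ℝ) ^ (k + 1) * t ^ (2 * (k + 1)) /
        (2 ^ (N + 2 * (k + 1)) * ((k + 1).factorial : ℝ) * ((N + (k + 1)).factorial : ℝ))) +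
      t ^ 2 * besselPsi (N + 2) t =
      2 * (N + 1) * ∑' k : ℕ, ((-1 : ℝ) ^ (k + 1) * t ^ (2 * (k + 1)) /
        (2 ^ (N + 1 + 2 * (k + 1)) * ((k + 1).factorial : ℝ) *
          ((N + 1 + (k + 1)).factorial : ℝ))) := by
    rw [besselPsi, ← tsum_mul_left, ← tsum_mul_left, ← hs0.tsum_add hs2]
    refine tsum_congr fun k => ?_
    rw [show N + (k + 1) = N + k + 1 by omega, show N + 1 + (k + 1) = N + k + 1 + 1 by omega,
      show N + 2 + k = N + k + 1 + 1 by omega, Nat.factorial_succ (N + k + 1),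
      Nat.factorial_succ k, show N + 2 * (k + 1) = N + 2 + 2 * k by omega,
      show N + 1 + 2 * (k + 1) = N + 2 + 2 * k + 1 by omega]
    push_cast
    field_simp
    ring
  rw [besselPsi, besselPsi.eq_def (N + 1), h0, h1, mul_add, ← e]
  simp only [Nat.factorial_succ, mul_zero, add_zero, pow_zero, Nat.factorial_zero, pow_succ]
  push_cast
  field_simp
  ring

lemma hasDerivAt_besselPsi_comp_mul (N : ℕ) (a t : ℝ) :
    HasDerivAt (fun s => besselPsi N (a * s)) (-(a ^ 2 * t) * besselPsi (N + 1) (a * t)) t := by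
  convert! (hasDerivAt_besselPsi N (a * t)).comp t ((hasDerivAt_id t).const_mul a) using 1
  rw [mul_one]
  ring

lemma hasDerivAt_pow_mul_besselPsi_comp_mul (N : ℕ) (a t : ℝ) :
    HasDerivAt (fun s => s ^ (2 * N + 2) * besselPsi (N + 1) (a * s))
      (t ^ (2 * N + 1) * besselPsi N (a * t)) t := by
  convert! (hasDerivAt_pow (2 * N + 2) t).mul (hasDerivAt_besselPsi_comp_mul (N + 1) a t) using 1
  have h := besselPsi_recurrence N (a * t)
  rw [eq_sub_of_add_eq h, show 2 * N + 2 - 1 = 2 * N + 1 by omega]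
  push_cast
  ring

lemma hasDerivAt_pow_mul_besselPsi (N : ℕ) (t : ℝ) :
    HasDerivAt (fun s => s ^ (2 * N + 2) * besselPsi (N + 1) s)
      (t ^ (2 * N + 1) * besselPsi N t) t := by
  simpa only [one_mul] using hasDerivAt_pow_mul_besselPsi_comp_mul N 1 t

/-! ### Boundedness and decay along a sequence -/

/-- The partial sums `J₀² + 2 J₁² + ⋯ + 2 Jₘ² + Jₘ₊₁²`. -/
noncomputable def besselEnergy (m : ℕ) (x : ℝ) : ℝ :=
  ∑ k ∈ Finset.range (m + 1), (besselJ k x ^ 2 + besselJ (k + 1) x ^ 2)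

lemma hasDerivAt_besselJ_sq_add (m : ℕ) (x : ℝ) :
    HasDerivAt (fun s => besselJ (m + 1) s ^ 2 + besselJ (m + 2) s ^ 2)
      (2 * (m + 1) * x ^ (2 * m + 1) * besselPsi (m + 1) x ^ 2 -
        2 * (m + 2) * x ^ (2 * m + 3) * besselPsi (m + 2) x ^ 2) x := by
  simp only [besselJ_eq_pow_mul_besselPsi]
  convert! (((hasDerivAt_pow (m + 1) x).mul (hasDerivAt_besselPsi (m + 1) x)).pow 2).add
    (((hasDerivAt_pow (m + 2) x).mul (hasDerivAt_besselPsi (m + 2) x)).pow 2) using 1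
  have h := besselPsi_recurrence (m + 1) x
  simp only [Pi.mul_apply]
  rw [show m + 1 - 1 = m by omega, show m + 2 - 1 = m + 1 by omega]
  push_cast at h ⊢
  linear_combination (2 * x ^ (2 * m + 3) * besselPsi (m + 2) x) * h

lemma hasDerivAt_besselEnergy (m : ℕ) (x : ℝ) :
    HasDerivAt (besselEnergy m) (-(2 * (m + 1) * x ^ (2 * m + 1) * besselPsi (m + 1) x ^ 2)) x := by
  induction m with
  | zero =>
    have e : besselEnergy 0 = fun s => besselPsi 0 s ^ 2 + (s * besselPsi 1 s) ^ 2 := by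
      ext s
      simp [besselEnergy, besselJ_eq_pow_mul_besselPsi]
    rw [e]
    convert! ((hasDerivAt_besselPsi 0 x).pow 2).add
      (((hasDerivAt_id x).mul (hasDerivAt_besselPsi 1 x)).pow 2) using 1
    have h := besselPsi_recurrence 0 x
    simp only [Pi.mul_apply, id]
    push_cast at h ⊢
    linear_combination (2 * x * besselPsi 1 x) * h
  | succ m ih =>
    have e : besselEnergy (m + 1) =
        fun s => besselEnergy m s + (besselJ (m + 1) s ^ 2 + besselJ (m + 2) s ^ 2) := by
      ext s
      rw [besselEnergy, Finset.sum_range_succ]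
      rfl
    rw [e]
    convert! ih.add (hasDerivAt_besselJ_sq_add m x) using 1
    push_cast
    ring

lemma besselEnergy_zero (m : ℕ) : besselEnergy m 0 = 1 := by
  rw [besselEnergy, Finset.sum_eq_single_of_mem 0 (by simp)]
  · simp [besselJ_eq_pow_mul_besselPsi, besselPsi_zero]
  · intro k _ hk
    simp [besselJ_eq_pow_mul_besselPsi, hk]

lemma besselEnergy_nonneg (m : ℕ) (x : ℝ) : 0 ≤ besselEnergy m x :=
  Finset.sum_nonneg fun _ _ => by positivity

lemma antitoneOn_besselEnergy (m : ℕ) : AntitoneOn (besselEnergy m) (Set.Ici 0) := by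
  refine antitoneOn_of_deriv_nonpos (convex_Ici 0)
    (fun x _ => (hasDerivAt_besselEnergy m x).continuousAt.continuousWithinAt)
    (fun x _ => (hasDerivAt_besselEnergy m x).differentiableAt.differentiableWithinAt)
    fun x hx => ?_
  rw [interior_Ici] at hx
  have hx' : 0 < x := hx
  rw [(hasDerivAt_besselEnergy m x).deriv, neg_nonpos]
  positivity

lemma besselEnergy_le_one (m : ℕ) {x : ℝ} (hx : 0 ≤ x) : besselEnergy m x ≤ 1 :=
  besselEnergy_zero m ▸ antitoneOn_besselEnergy m (Set.mem_Ici.mpr le_rfl) hx hx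

lemma abs_besselJ_le_one (m : ℕ) {x : ℝ} (hx : 0 ≤ x) : |besselJ m x| ≤ 1 := by
  rw [← sq_le_one_iff_abs_le_one]
  refine le_trans ?_ (besselEnergy_le_one m hx)
  exact (le_add_of_nonneg_right (sq_nonneg _)).trans
    (Finset.single_le_sum (f := fun k => besselJ k x ^ 2 + besselJ (k + 1) x ^ 2)
      (fun _ _ => by positivity) (Finset.self_mem_range_succ m))

lemma besselJ_succ_sq_le_half (m : ℕ) {x : ℝ} (hx : 0 ≤ x) : besselJ (m + 1) x ^ 2 ≤ 1 / 2 := by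
  have h := besselEnergy_le_one (m + 1) hx
  rw [besselEnergy, Finset.sum_range_succ, Finset.sum_range_succ] at h
  have h1 : 0 ≤ ∑ k ∈ Finset.range m, (besselJ k x ^ 2 + besselJ (k + 1) x ^ 2) :=
    Finset.sum_nonneg fun _ _ => by positivity
  nlinarith [sq_nonneg (besselJ m x), sq_nonneg (besselJ (m + 1 + 1) x)]

/-- Arbitrarily far out, the Bessel functions of orders `1, …, M` are simultaneously small. -/
lemma exists_sum_besselJ_succ_sq_lt (M : ℕ) {ε : ℝ} (hε : 0 < ε) (X : ℝ) :
    ∃ x, X ≤ x ∧ ∑ k ∈ Finset.range M, besselJ (k + 1) x ^ 2 < ε := by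
  by_contra! hcon
  set Y := max X 1
  have hY : 1 ≤ Y := le_max_right _ _
  let F : ℝ → ℝ := fun x => (∑ m ∈ Finset.range M, besselEnergy m x) + 2 * ε * Real.log x
  have hF : ∀ x, Y ≤ x → HasDerivAt F ((∑ m ∈ Finset.range M,
      -(2 * (m + 1) * x ^ (2 * m + 1) * besselPsi (m + 1) x ^ 2)) + 2 * ε * x⁻¹) x := by
    intro x hx
    exact (HasDerivAt.fun_sum fun m _ => hasDerivAt_besselEnergy m x).add
      ((Real.hasDerivAt_log (by linarith)).const_mul _)
  have hanti : AntitoneOn F (Set.Ici Y) := by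
    refine antitoneOn_of_deriv_nonpos (convex_Ici Y)
      (fun x hx => (hF x hx).continuousAt.continuousWithinAt)
      (fun x hx => (hF x (interior_subset hx)).differentiableAt.differentiableWithinAt)
      fun x hx => ?_
    have hx' : Y ≤ x := interior_subset hx
    have hx0 : 0 < x := by linarith
    rw [(hF x hx').deriv]
    have h1 := hcon x ((le_max_left _ _).trans hx')
    have h2 : ∑ m ∈ Finset.range M, -(2 * ((m : ℝ) + 1) * x ^ (2 * m + 1) *
        besselPsi (m + 1) x ^ 2) ≤ ∑ m ∈ Finset.range M, -2 * x⁻¹ * besselJ (m + 1) x ^ 2 := by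
      refine Finset.sum_le_sum fun m _ => ?_
      rw [besselJ_eq_pow_mul_besselPsi]
      have e : -2 * x⁻¹ * (x ^ (m + 1) * besselPsi (m + 1) x) ^ 2 =
          -(2 * x ^ (2 * m + 1) * besselPsi (m + 1) x ^ 2) := by
        field_simp
        ring
      rw [e]
      have : 0 ≤ (m : ℝ) * (x ^ (2 * m + 1) * besselPsi (m + 1) x ^ 2) := by positivity
      linarith
    rw [← Finset.mul_sum] at h2
    have h3 : 0 ≤ x⁻¹ := by positivity
    nlinarith [mul_le_mul_of_nonneg_left h1 h3]
  have hbound : ∀ x, Y ≤ x → Real.log x ≤ F Y / (2 * ε) := by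
    intro x hx
    rw [le_div_iff₀ (by positivity)]
    have h1 : F x ≤ F Y := hanti (Set.mem_Ici.mpr le_rfl) hx hx
    have h2 : 0 ≤ ∑ m ∈ Finset.range M, besselEnergy m x :=
      Finset.sum_nonneg fun m _ => besselEnergy_nonneg m x
    simp only [F] at h1 ⊢
    linarith
  obtain ⟨x, hx1, hx2⟩ := ((Real.tendsto_log_atTop.eventually_gt_atTop (F Y / (2 * ε))).and
    (Filter.eventually_ge_atTop Y)).exists
  linarith [hbound x hx2]

/-- There is a sequence tending to infinity along which all the Bessel functions of order at
most `M` tend to zero. -/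
lemma exists_seq_tendsto_besselJ (M : ℕ) : ∃ x : ℕ → ℝ, Filter.Tendsto x Filter.atTop Filter.atTop ∧
    ∀ k ≤ M, Filter.Tendsto (fun i => besselJ k (x i)) Filter.atTop (nhds 0) := by
  choose x hx1 hx2 using fun i : ℕ =>
    exists_sum_besselJ_succ_sq_lt (M + 2) (Nat.one_div_pos_of_nat (α := ℝ) (n := i)) (i + 1)
  have hx : Filter.Tendsto x Filter.atTop Filter.atTop :=
    Filter.tendsto_atTop_mono (fun i => by linarith [hx1 i]) tendsto_natCast_atTop_atTop
  have hlim : ∀ k < M + 2, Filter.Tendsto (fun i => besselJ (k + 1) (x i)) Filter.atTop (nhds 0) := by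
    intro k hk
    have h : Filter.Tendsto (fun i => besselJ (k + 1) (x i) ^ 2) Filter.atTop (nhds 0) := by
      refine squeeze_zero (fun _ => sq_nonneg _) (fun i => ?_) tendsto_one_div_add_atTop_nhds_zero_nat
      exact (Finset.single_le_sum (f := fun k => besselJ (k + 1) (x i) ^ 2)
        (fun _ _ => sq_nonneg _) (Finset.mem_range.mpr hk)).trans (hx2 i).le
    simpa [abs_eq_zero, tendsto_zero_iff_abs_tendsto_zero, Real.sqrt_sq_eq_abs, Function.comp_def]
      using h.sqrt
  refine ⟨x, hx, fun k hk => ?_⟩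
  rcases k with _ | k
  · have e : (fun i => besselJ 0 (x i)) =
        fun i => 2 * (x i)⁻¹ * besselJ 1 (x i) - besselJ 2 (x i) := by
      ext i
      have h := besselPsi_recurrence 0 (x i)
      have h0 : x i ≠ 0 := by
        have : (0 : ℝ) ≤ i := i.cast_nonneg
        linarith [hx1 i]
      simp only [besselJ_eq_pow_mul_besselPsi]
      push_cast at h
      field_simp
      simp only [zero_add] at h ⊢
      linear_combination h
    rw [e]
    simpa using ((hx.inv_tendsto_atTop.const_mul 2).mul (hlim 0 (by omega))).sub
      (hlim 1 (by omega))
  · exact hlim k (by omega)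

/-! ### Behaviour up to the first zero -/

lemma besselPsi_pos_of_lt {N : ℕ} {j : ℝ} (hfirst : ∀ t, 0 < t → t < j → besselJ N t ≠ 0)
    {t : ℝ} (ht0 : 0 ≤ t) (htj : t < j) : 0 < besselPsi N t := by
  have h0 : 0 < besselPsi N 0 := by
    rw [besselPsi_zero]
    positivity
  by_contra! hneg
  obtain ⟨s, hs, hs0⟩ := intermediate_value_Icc' ht0 (continuous_besselPsi N).continuousOn
    ⟨hneg, h0.le⟩
  rcases hs.1.eq_or_lt with rfl | hpos
  · exact h0.ne' hs0
  · refine hfirst s hpos (hs.2.trans_lt htj) ?_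
    rw [besselJ_eq_pow_mul_besselPsi, hs0, mul_zero]

lemma besselPsi_succ_pos {m : ℕ} {j : ℝ} (h : ∀ t, 0 < t → t < j → 0 < besselPsi m t)
    {t : ℝ} (ht0 : 0 < t) (htj : t ≤ j) : 0 < besselPsi (m + 1) t := by
  have hmono : StrictMonoOn (fun s => s ^ (2 * m + 2) * besselPsi (m + 1) s) (Set.Icc 0 t) := by
    refine strictMonoOn_of_deriv_pos (convex_Icc 0 t)
      (fun x _ => (hasDerivAt_pow_mul_besselPsi m x).continuousAt.continuousWithinAt) fun x hx => ?_
    rw [interior_Icc] at hx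
    rw [(hasDerivAt_pow_mul_besselPsi m x).deriv]
    have := hx.1
    have := h x hx.1 (hx.2.trans_le htj)
    positivity
  have h1 := hmono (Set.left_mem_Icc.mpr ht0.le) (Set.right_mem_Icc.mpr ht0.le) ht0
  simp only [ne_eq, Nat.add_eq_zero_iff, OfNat.ofNat_ne_zero, and_false, not_false_eq_true,
    zero_pow, zero_mul] at h1
  exact pos_of_mul_pos_right h1 (by positivity)

lemma besselPsi_add_succ_pos {N : ℕ} {j : ℝ} (h : ∀ t, 0 < t → t < j → 0 < besselPsi N t) (k : ℕ)
    {t : ℝ} (ht0 : 0 < t) (htj : t ≤ j) : 0 < besselPsi (N + k + 1) t := by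
  induction k generalizing t with
  | zero => exact besselPsi_succ_pos h ht0 htj
  | succ k ih => exact besselPsi_succ_pos (fun s hs hsj => ih hs hsj.le) ht0 htj

/-- The first zero `j` of `J_N` satisfies `j² ≤ 2 (N + 1) (N + 3)`. -/
lemma sq_le_of_besselPsi_eq_zero {N : ℕ} {j : ℝ} (hj : 0 < j) (hz : besselPsi N j = 0)
    (h : ∀ t, 0 < t → t < j → 0 < besselPsi N t) : j ^ 2 ≤ 2 * (N + 1) * (N + 3) := by
  have h2 : 0 < besselPsi (N + 2) j := besselPsi_add_succ_pos h 1 hj le_rfl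
  have h3 : 0 < besselPsi (N + 3) j := besselPsi_add_succ_pos h 2 hj le_rfl
  have h4 : 0 < besselPsi (N + 4) j := besselPsi_add_succ_pos h 3 hj le_rfl
  have r0 := besselPsi_recurrence N j
  have r1 := besselPsi_recurrence (N + 1) j
  have r2 := besselPsi_recurrence (N + 2) j
  push_cast at r1 r2
  rw [hz, zero_add] at r0
  have hlow : besselPsi (N + 2) j ≤ 2 * (N + 3) * besselPsi (N + 3) j := by
    have : 0 ≤ j ^ 2 * besselPsi (N + 4) j := by positivity
    linarith
  have key : j ^ 2 * (2 * (N + 2)) * besselPsi (N + 2) j ≤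
      2 * (N + 1) * (N + 3) * (2 * (N + 2)) * besselPsi (N + 2) j := by
    have hc : (0 : ℝ) ≤ j ^ 2 * (N + 1) := by positivity
    have hm := mul_le_mul_of_nonneg_left hlow hc
    have e : (N + 3) * (j ^ 2 * besselPsi (N + 2) j) +
        j ^ 2 * (N + 1) * (2 * (N + 3) * besselPsi (N + 3) j) =
        2 * (N + 1) * (N + 3) * (2 * (N + 2)) * besselPsi (N + 2) j := by
      linear_combination (N + 3 : ℝ) * r0 + 2 * (N + 1) * (N + 3 : ℝ) * r1
    linarith
  have hpos : (0 : ℝ) < 2 * (N + 2) * besselPsi (N + 2) j := by positivity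
  refine le_of_mul_le_mul_right ?_ hpos
  linarith

/-- The continuous extension of `ψ(t) / (j² - t²)`, for a zero `j` of `ψ`. -/
noncomputable def besselQuot (N : ℕ) (j t : ℝ) : ℝ := -dslope (besselPsi N) j t / (j + t)

lemma besselQuot_mul {N : ℕ} {j t : ℝ} (hj : 0 < j) (hz : besselPsi N j = 0) (ht : 0 ≤ t) :
    besselQuot N j t * (j ^ 2 - t ^ 2) = besselPsi N t := by
  have h := sub_smul_dslope (besselPsi N) j t
  rw [hz, sub_zero, smul_eq_mul] at h
  rw [besselQuot, ← h]
  have : j + t ≠ 0 := by positivity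
  field_simp
  ring

lemma continuousOn_besselQuot (N : ℕ) {j : ℝ} (hj : 0 < j) :
    ContinuousOn (besselQuot N j) (Set.Ici 0) := by
  have hc : Continuous (dslope (besselPsi N) j) := by
    rw [← continuousOn_univ, continuousOn_dslope Filter.univ_mem]
    exact ⟨(continuous_besselPsi N).continuousOn, (hasDerivAt_besselPsi N j).differentiableAt⟩
  refine hc.neg.continuousOn.div (by fun_prop) fun t ht => ?_
  have : 0 ≤ t := ht
  positivity

/-- The numerator of the derivative of `ψ(t) / (j² - t²)`, up to a factor `t`. -/
noncomputable def besselQuotNum (N : ℕ) (j t : ℝ) : ℝ :=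
  2 * besselPsi N t - (j ^ 2 - t ^ 2) * besselPsi (N + 1) t

lemma hasDerivAt_besselQuotNum (N : ℕ) (j t : ℝ) :
    HasDerivAt (besselQuotNum N j) ((j ^ 2 - t ^ 2) * t * besselPsi (N + 2) t) t := by
  convert! ((hasDerivAt_besselPsi N t).const_mul 2).sub
    (((hasDerivAt_pow 2 t).const_sub (j ^ 2)).mul (hasDerivAt_besselPsi (N + 1) t)) using 1
  push_cast
  ring

lemma hasDerivAt_besselQuot {N : ℕ} {j t : ℝ} (hj : 0 < j) (hz : besselPsi N j = 0) (ht0 : 0 < t)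
    (htj : t < j) :
    HasDerivAt (besselQuot N j) (t * besselQuotNum N j t / (j ^ 2 - t ^ 2) ^ 2) t := by
  have hne : j ^ 2 - t ^ 2 ≠ 0 := by nlinarith
  have h := (hasDerivAt_besselPsi N t).div ((hasDerivAt_pow 2 t).const_sub (j ^ 2)) hne
  refine (h.congr_of_eventuallyEq ?_).congr_deriv ?_
  · filter_upwards [Ioo_mem_nhds ht0 htj] with s hs
    have : j ^ 2 - s ^ 2 ≠ 0 := by nlinarith [hs.1, hs.2]
    rw [Pi.div_apply, eq_div_iff this]
    exact besselQuot_mul hj hz hs.1.le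
  · rw [besselQuotNum]
    push_cast
    ring

lemma besselQuotNum_nonpos {N : ℕ} {j t : ℝ} (hz : besselPsi N j = 0)
    (h : ∀ t, 0 < t → t < j → 0 < besselPsi N t) (ht0 : 0 ≤ t) (htj : t ≤ j) :
    besselQuotNum N j t ≤ 0 := by
  have hmono : MonotoneOn (besselQuotNum N j) (Set.Icc 0 j) := by
    refine monotoneOn_of_deriv_nonneg (convex_Icc 0 j)
      (fun x _ => (hasDerivAt_besselQuotNum N j x).continuousAt.continuousWithinAt)
      (fun x _ => (hasDerivAt_besselQuotNum N j x).differentiableAt.differentiableWithinAt)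
      fun x hx => ?_
    rw [interior_Icc] at hx
    rw [(hasDerivAt_besselQuotNum N j x).deriv]
    have h1 : 0 < besselPsi (N + 2) x := besselPsi_add_succ_pos h 1 hx.1 hx.2.le
    have h2 : 0 ≤ j ^ 2 - x ^ 2 := by nlinarith [hx.1, hx.2]
    have h3 := hx.1.le
    positivity
  have := hmono ⟨ht0, htj⟩ (Set.right_mem_Icc.mpr (ht0.trans htj)) htj
  rwa [show besselQuotNum N j j = 0 by simp [besselQuotNum, hz]] at this

lemma exists_abs_deriv_besselQuot_le {N : ℕ} {j : ℝ} (hz : besselPsi N j = 0)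
    (h : ∀ t, 0 < t → t < j → 0 < besselPsi N t) : ∃ M : ℝ, ∀ t, 0 < t → t < j →
      |t * besselQuotNum N j t / (j ^ 2 - t ^ 2) ^ 2| ≤ M := by
  obtain ⟨M, hM⟩ := isCompact_Icc.exists_bound_of_continuousOn
    (continuous_besselPsi (N + 2)).continuousOn (s := Set.Icc 0 j)
  refine ⟨j * (M / 4), fun t ht0 htj => ?_⟩
  have hM0 : 0 ≤ M := (norm_nonneg _).trans (hM t ⟨ht0.le, htj.le⟩)
  have hd : ∀ x, HasDerivAt (fun x => besselQuotNum N j x + M / 4 * (j ^ 2 - x ^ 2) ^ 2)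
      ((j ^ 2 - x ^ 2) * x * besselPsi (N + 2) x + M / 4 * (2 * (j ^ 2 - x ^ 2) * (-(2 * x)))) x := by
    intro x
    convert! (hasDerivAt_besselQuotNum N j x).add
      ((((hasDerivAt_pow 2 x).const_sub (j ^ 2)).pow 2).const_mul (M / 4)) using 1
    push_cast
    ring
  have hanti : AntitoneOn (fun x => besselQuotNum N j x + M / 4 * (j ^ 2 - x ^ 2) ^ 2)
      (Set.Icc 0 j) := by
    refine antitoneOn_of_deriv_nonpos (convex_Icc 0 j)
      (fun x _ => (hd x).continuousAt.continuousWithinAt)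
      (fun x _ => (hd x).differentiableAt.differentiableWithinAt) fun x hx => ?_
    rw [interior_Icc] at hx
    rw [(hd x).deriv]
    have h1 := (le_abs_self _).trans (hM x ⟨hx.1.le, hx.2.le⟩)
    have h2 : 0 ≤ (j ^ 2 - x ^ 2) * x := mul_nonneg (by nlinarith [hx.1, hx.2]) hx.1.le
    nlinarith [mul_le_mul_of_nonneg_left h1 h2]
  have hge : -(M / 4 * (j ^ 2 - t ^ 2) ^ 2) ≤ besselQuotNum N j t := by
    have := hanti ⟨ht0.le, htj.le⟩ (Set.right_mem_Icc.mpr (ht0.trans htj).le) htj.le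
    simp only [besselQuotNum, hz, sub_self] at this ⊢
    linarith
  have hle := besselQuotNum_nonpos hz h ht0.le htj.le
  have hpos : 0 < (j ^ 2 - t ^ 2) ^ 2 := by
    have : 0 < j ^ 2 - t ^ 2 := by nlinarith
    positivity
  rw [abs_div, abs_mul, abs_of_pos ht0, abs_of_nonpos hle, abs_of_pos hpos, div_le_iff₀ hpos,
    mul_assoc]
  exact mul_le_mul htj.le (by linarith) (by linarith) (ht0.trans htj).le

/-- Comparison of `ψ` with the parabola that agrees with it at `0` and at the first zero. -/
lemma besselPsi_le_parabola {N : ℕ} {j t : ℝ} (hj : 0 < j) (hz : besselPsi N j = 0)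
    (h : ∀ t, 0 < t → t < j → 0 < besselPsi N t) (ht0 : 0 ≤ t) (htj : t ≤ j) :
    besselPsi N t ≤ besselPsi N 0 * (1 - (t / j) ^ 2) := by
  have hanti : AntitoneOn (besselQuot N j) (Set.Icc 0 j) := by
    refine antitoneOn_of_deriv_nonpos (convex_Icc 0 j)
      ((continuousOn_besselQuot N hj).mono Set.Icc_subset_Ici_self) (fun x hx => ?_) fun x hx => ?_
    all_goals rw [interior_Icc] at hx
    · exact (hasDerivAt_besselQuot hj hz hx.1 hx.2).differentiableAt.differentiableWithinAt
    · rw [(hasDerivAt_besselQuot hj hz hx.1 hx.2).deriv]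
      exact div_nonpos_of_nonpos_of_nonneg (mul_nonpos_of_nonneg_of_nonpos hx.1.le
        (besselQuotNum_nonpos hz h hx.1.le hx.2.le)) (sq_nonneg _)
  have hle := hanti (Set.left_mem_Icc.mpr hj.le) ⟨ht0, htj⟩ ht0
  rw [← besselQuot_mul hj hz ht0, ← besselQuot_mul hj hz le_rfl]
  have h2 : 0 ≤ j ^ 2 - t ^ 2 := by nlinarith
  calc besselQuot N j t * (j ^ 2 - t ^ 2) ≤ besselQuot N j 0 * (j ^ 2 - t ^ 2) := by gcongr
    _ = _ := by
      field_simp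
      ring

/-! ### Integral identities -/

lemma integral_pow_mul_besselPsi_mul_besselPsi (N : ℕ) (a b X : ℝ) :
    (a ^ 2 - b ^ 2) * ∫ t in (0 : ℝ)..X, t ^ (2 * N + 1) * (besselPsi N (a * t) * besselPsi N (b * t)) =
      X ^ (2 * N + 2) * (a ^ 2 * besselPsi (N + 1) (a * X) * besselPsi N (b * X) -
        b ^ 2 * besselPsi N (a * X) * besselPsi (N + 1) (b * X)) := by
  have hc := continuous_besselPsi N
  have hd : ∀ t, HasDerivAt (fun t => a ^ 2 * ((t ^ (2 * N + 2) * besselPsi (N + 1) (a * t)) *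
        besselPsi N (b * t)) - b ^ 2 * ((t ^ (2 * N + 2) * besselPsi (N + 1) (b * t)) *
        besselPsi N (a * t)))
      ((a ^ 2 - b ^ 2) * (t ^ (2 * N + 1) * (besselPsi N (a * t) * besselPsi N (b * t)))) t := by
    intro t
    convert! (((hasDerivAt_pow_mul_besselPsi_comp_mul N a t).mul
        (hasDerivAt_besselPsi_comp_mul N b t)).const_mul (a ^ 2)).sub
      (((hasDerivAt_pow_mul_besselPsi_comp_mul N b t).mul
        (hasDerivAt_besselPsi_comp_mul N a t)).const_mul (b ^ 2)) using 1
    ring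
  rw [← intervalIntegral.integral_const_mul, intervalIntegral.integral_eq_sub_of_hasDerivAt
    (fun t _ => hd t) (Continuous.intervalIntegrable (by fun_prop) _ _)]
  simp only [ne_eq, Nat.add_eq_zero_iff, OfNat.ofNat_ne_zero, and_false, not_false_eq_true,
    zero_pow, zero_mul, mul_zero, sub_zero]
  ring

/-- The kernel `∫₀ʲ t^{2N+1} ψ(t) ψ(rt) dt`, proportional to `ψ(jr) / (1 - r²)`. -/
noncomputable def besselKernel (N : ℕ) (j r : ℝ) : ℝ :=
  ∫ t in (0 : ℝ)..j, t ^ (2 * N + 1) * (besselPsi N t * besselPsi N (r * t))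

lemma continuous_besselKernel (N : ℕ) (j : ℝ) : Continuous (besselKernel N j) := by
  have hc := continuous_besselPsi N
  exact intervalIntegral.continuous_parametric_intervalIntegral_of_continuous' (by fun_prop) 0 j

lemma one_sub_sq_mul_besselKernel {N : ℕ} {j : ℝ} (hz : besselPsi N j = 0) (r : ℝ) :
    (1 - r ^ 2) * besselKernel N j r =
      j ^ (2 * N + 2) * besselPsi (N + 1) j * besselPsi N (j * r) := by
  have h := integral_pow_mul_besselPsi_mul_besselPsi N 1 r j
  simp only [one_mul, one_pow, hz, mul_zero, zero_mul, sub_zero] at h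
  rw [besselKernel, h, mul_comm r j]
  ring

lemma besselPsi_sq_div_eq {N : ℕ} {j : ℝ} (hj : 0 < j) (hz : besselPsi N j = 0)
    (h1 : 0 < besselPsi (N + 1) j) {r : ℝ} (hr : 0 ≤ r) :
    besselPsi N (j * r) ^ 2 / (1 - r ^ 2) =
      besselPsi N (j * r) * besselKernel N j r / (j ^ (2 * N + 2) * besselPsi (N + 1) j) := by
  rcases eq_or_ne r 1 with rfl | hne
  · simp [hz]
  · have hr1 : 1 - r ^ 2 ≠ 0 := by
      rw [sub_ne_zero]
      intro h
      exact hne ((pow_eq_one_iff_of_nonneg hr two_ne_zero).mp h.symm)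
    rw [div_eq_div_iff hr1 (by positivity)]
    linear_combination -besselPsi N (j * r) * one_sub_sq_mul_besselKernel hz r

/-- Integrals against `ψ(t) / (j² - t²)` gain decay through an integration by parts. -/
lemma exists_abs_integral_besselQuot_le {N : ℕ} {j : ℝ} (hj : 0 < j) (hz : besselPsi N j = 0)
    (h : ∀ t, 0 < t → t < j → 0 < besselPsi N t) (m : ℕ) : ∃ C : ℝ, ∀ R, 0 < R →
      |R ^ (m + 1) * ∫ t in (0 : ℝ)..j,
        besselQuot N j t * (t ^ (2 * m + 1) * besselPsi m (R * t))| ≤ C := by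
  obtain ⟨M, hM⟩ := exists_abs_deriv_besselQuot_le hz h
  have hc := continuous_besselPsi m
  have hc1 := continuous_besselPsi (m + 1)
  refine ⟨|besselQuot N j j| * j ^ (m + 1) + M * j ^ (m + 1) * |j - 0|, fun R hR => ?_⟩
  have hM0 : 0 ≤ M := (abs_nonneg _).trans (hM (j / 2) (by linarith) (by linarith))
  have hbound : ∀ t, 0 ≤ t → t ≤ j →
      |R ^ (m + 1) * (t ^ (2 * m + 2) * besselPsi (m + 1) (R * t))| ≤ j ^ (m + 1) := by
    intro t ht0 htj
    have e : R ^ (m + 1) * (t ^ (2 * m + 2) * besselPsi (m + 1) (R * t)) =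
        t ^ (m + 1) * besselJ (m + 1) (R * t) := by
      rw [besselJ_eq_pow_mul_besselPsi, mul_pow]
      ring
    rw [e, abs_mul, abs_of_nonneg (by positivity)]
    calc t ^ (m + 1) * |besselJ (m + 1) (R * t)| ≤ j ^ (m + 1) * 1 := by
          gcongr
          exact abs_besselJ_le_one _ (by positivity)
      _ = _ := mul_one _
  have hq : ContinuousOn (besselQuot N j) (Set.uIcc 0 j) := by
    rw [Set.uIcc_of_le hj.le]
    exact (continuousOn_besselQuot N hj).mono Set.Icc_subset_Ici_self
  have hnum : Continuous (besselQuotNum N j) :=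
    continuous_iff_continuousAt.mpr fun t => (hasDerivAt_besselQuotNum N j t).continuousAt
  have hfint : IntervalIntegrable (fun t => t * besselQuotNum N j t / (j ^ 2 - t ^ 2) ^ 2)
      volume 0 j := by
    rw [intervalIntegrable_iff_integrableOn_Ioo_of_le hj.le]
    refine IntegrableOn.of_bound measure_Ioo_lt_top ?_ M ?_
    · exact (by fun_prop : Measurable _).aestronglyMeasurable
    · exact (ae_restrict_iff' measurableSet_Ioo).mpr (.of_forall fun t ht => hM t ht.1 ht.2)
  have hparts := intervalIntegral.integral_mul_deriv_eq_deriv_mul_of_hasDerivAt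
    (a := 0) (b := j) (u := besselQuot N j)
    (v := fun t => t ^ (2 * m + 2) * besselPsi (m + 1) (R * t)) hq (by fun_prop)
    (fun t ht => hasDerivAt_besselQuot hj hz (by simpa [hj.le] using ht.1)
      (by simpa [hj.le] using ht.2))
    (fun t _ => hasDerivAt_pow_mul_besselPsi_comp_mul m R t) hfint
    (Continuous.intervalIntegrable (by fun_prop) _ _)
  simp only [ne_eq, Nat.add_eq_zero_iff, OfNat.ofNat_ne_zero, and_false, not_false_eq_true,
    zero_pow, zero_mul, mul_zero, sub_zero] at hparts
  rw [hparts, mul_sub, ← intervalIntegral.integral_const_mul]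
  refine (abs_sub _ _).trans (add_le_add ?_ ?_)
  · rw [mul_left_comm, abs_mul]
    gcongr
    exact hbound j hj.le le_rfl
  · rw [← Real.norm_eq_abs]
    refine intervalIntegral.norm_integral_le_of_norm_le_const_ae ?_
    have hae : ∀ᵐ t : ℝ, t ≠ j := by simp [ae_iff]
    filter_upwards [hae] with t hne ht
    rw [Set.uIoc_of_le hj.le] at ht
    rw [mul_left_comm, norm_mul]
    exact mul_le_mul (hM t ht.1 (lt_of_le_of_ne ht.2 hne)) (hbound t ht.1.le ht.2) (abs_nonneg _) hM0

lemma integral_pow_mul_besselPsi_sq_div_eq {N : ℕ} {j : ℝ} (hj : 0 < j) (hz : besselPsi N j = 0)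
    (h1 : 0 < besselPsi (N + 1) j) {R : ℝ} (hR : 0 ≤ R) :
    (j ^ (2 * N + 2) * besselPsi (N + 1) j) *
        ∫ r in (0 : ℝ)..R, r ^ (2 * N + 1) * (besselPsi N (j * r) ^ 2 / (1 - r ^ 2)) =
      R ^ (2 * N + 2) * j ^ 2 * besselPsi (N + 1) (j * R) *
          (∫ t in (0 : ℝ)..j, besselQuot N j t * (t ^ (2 * N + 1) * besselPsi N (R * t))) -
        R ^ (2 * N + 2) * besselPsi N (j * R) *
          ∫ t in (0 : ℝ)..j, besselQuot N j t *
            (t ^ (2 * (N + 1) + 1) * besselPsi (N + 1) (R * t)) := by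
  have hc := continuous_besselPsi N
  have hc1 := continuous_besselPsi (N + 1)
  have hq : ContinuousOn (besselQuot N j) (Set.uIcc 0 j) := by
    rw [Set.uIcc_of_le hj.le]
    exact (continuousOn_besselQuot N hj).mono Set.Icc_subset_Ici_self
  calc _ = ∫ r in (0 : ℝ)..R, ∫ t in (0 : ℝ)..j, r ^ (2 * N + 1) * besselPsi N (j * r) *
          (t ^ (2 * N + 1) * (besselPsi N t * besselPsi N (r * t))) := by
        rw [← intervalIntegral.integral_const_mul]
        refine intervalIntegral.integral_congr fun r hr => ?_
        rw [Set.uIcc_of_le hR] at hr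
        rw [besselPsi_sq_div_eq hj hz h1 hr.1, intervalIntegral.integral_const_mul, ← besselKernel]
        field_simp
    _ = ∫ t in (0 : ℝ)..j, ∫ r in (0 : ℝ)..R, r ^ (2 * N + 1) * besselPsi N (j * r) *
          (t ^ (2 * N + 1) * (besselPsi N t * besselPsi N (r * t))) := by
        refine intervalIntegral_intervalIntegral_swap ?_
        rw [Set.uIoc_of_le hR, Set.uIoc_of_le hj.le]
        refine IntegrableOn.mono_set (ContinuousOn.integrableOn_compact
          (isCompact_Icc.prod isCompact_Icc) (Continuous.continuousOn ?_))
          (Set.prod_mono Set.Ioc_subset_Icc_self Set.Ioc_subset_Icc_self)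
        simp only [Function.uncurry_def]
        fun_prop
    _ = ∫ t in (0 : ℝ)..j,
          (R ^ (2 * N + 2) * j ^ 2 * besselPsi (N + 1) (j * R) *
              (besselQuot N j t * (t ^ (2 * N + 1) * besselPsi N (R * t))) -
            R ^ (2 * N + 2) * besselPsi N (j * R) *
              (besselQuot N j t * (t ^ (2 * (N + 1) + 1) * besselPsi (N + 1) (R * t)))) := by
        refine intervalIntegral.integral_congr fun t ht => ?_
        rw [Set.uIcc_of_le hj.le] at ht
        have hl := integral_pow_mul_besselPsi_mul_besselPsi N j t R
        have e : ∫ r in (0 : ℝ)..R, r ^ (2 * N + 1) * besselPsi N (j * r) *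
            (t ^ (2 * N + 1) * (besselPsi N t * besselPsi N (r * t))) =
            t ^ (2 * N + 1) * besselPsi N t * ∫ r in (0 : ℝ)..R, r ^ (2 * N + 1) *
              (besselPsi N (j * r) * besselPsi N (t * r)) := by
          rw [← intervalIntegral.integral_const_mul]
          refine intervalIntegral.integral_congr fun r _ => ?_
          simp only [mul_comm t r]
          ring
        rw [e, ← besselQuot_mul hj hz ht.1, mul_comm R t]
        linear_combination t ^ (2 * N + 1) * besselQuot N j t * hl
    _ = _ := by
        rw [intervalIntegral.integral_sub, intervalIntegral.integral_const_mul,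
          intervalIntegral.integral_const_mul]
        all_goals
          refine ContinuousOn.intervalIntegrable ?_
          fun_prop

lemma tendsto_integral_pow_mul_besselPsi_sq_div {N : ℕ} {j : ℝ} (hj : 0 < j)
    (hz : besselPsi N j = 0) (h : ∀ t, 0 < t → t < j → 0 < besselPsi N t) {x : ℕ → ℝ}
    (hx : Filter.Tendsto x Filter.atTop Filter.atTop)
    (hN : Filter.Tendsto (fun i => besselJ N (j * x i)) Filter.atTop (nhds 0))
    (hN1 : Filter.Tendsto (fun i => besselJ (N + 1) (j * x i)) Filter.atTop (nhds 0)) :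
    Filter.Tendsto (fun i => ∫ r in (0 : ℝ)..x i,
      r ^ (2 * N + 1) * (besselPsi N (j * r) ^ 2 / (1 - r ^ 2))) Filter.atTop (nhds 0) := by
  have h1 : 0 < besselPsi (N + 1) j := besselPsi_succ_pos h hj le_rfl
  obtain ⟨C, hC⟩ := exists_abs_integral_besselQuot_le hj hz h N
  obtain ⟨D, hD⟩ := exists_abs_integral_besselQuot_le hj hz h (N + 1)
  set κ := j ^ (2 * N + 2) * besselPsi (N + 1) j
  have hκ : 0 < κ := by positivity
  have hlim : Filter.Tendsto (fun i => (j ^ 2 * (j ^ (N + 1))⁻¹ * |besselJ (N + 1) (j * x i)| * C +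
      (j ^ N)⁻¹ * |besselJ N (j * x i)| * D) / κ) Filter.atTop (nhds 0) := by
    simpa using ((((hN1.abs).const_mul (j ^ 2 * (j ^ (N + 1))⁻¹)).mul_const C).add
      (((hN.abs).const_mul (j ^ N)⁻¹).mul_const D)).div_const κ
  refine squeeze_zero_norm' ?_ hlim
  filter_upwards [hx.eventually_gt_atTop 0] with i hi
  rw [le_div_iff₀ hκ, Real.norm_eq_abs, mul_comm, ← abs_of_pos hκ, ← abs_mul,
    integral_pow_mul_besselPsi_sq_div_eq hj hz h1 hi.le]
  refine (abs_sub _ _).trans (add_le_add ?_ ?_)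
  · calc _ = |j ^ 2 * (j ^ (N + 1))⁻¹ * besselJ (N + 1) (j * x i) * (x i ^ (N + 1) *
          ∫ t in (0 : ℝ)..j, besselQuot N j t * (t ^ (2 * N + 1) * besselPsi N (x i * t)))| := by
          rw [besselJ_eq_pow_mul_besselPsi]
          congr 1
          field_simp
          ring
      _ ≤ _ := by
          rw [abs_mul, abs_mul, abs_of_pos (by positivity : 0 < j ^ 2 * (j ^ (N + 1))⁻¹)]
          gcongr
          exact hC _ hi
  · calc _ = |(j ^ N)⁻¹ * besselJ N (j * x i) * (x i ^ (N + 1 + 1) *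
          ∫ t in (0 : ℝ)..j, besselQuot N j t *
            (t ^ (2 * (N + 1) + 1) * besselPsi (N + 1) (x i * t)))| := by
          rw [besselJ_eq_pow_mul_besselPsi]
          congr 1
          field_simp
          ring
      _ ≤ _ := by
          rw [abs_mul, abs_mul, abs_of_pos (by positivity : 0 < (j ^ N)⁻¹)]
          gcongr
          exact hD _ hi

lemma integral_pow_mul_besselPsi_sq (n : ℕ) {j : ℝ} (hj : 0 < j) (R : ℝ) :
    ∫ r in (0 : ℝ)..R, r ^ (2 * n + 1) * besselPsi (n + 1) (j * r) ^ 2 =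
      (1 - besselEnergy n (j * R)) / (2 * (n + 1) * j ^ (2 * n + 2)) := by
  have hc := continuous_besselPsi (n + 1)
  have hd : ∀ r, HasDerivAt (fun r => -besselEnergy n (j * r) / (2 * (n + 1) * j ^ (2 * n + 2)))
      (r ^ (2 * n + 1) * besselPsi (n + 1) (j * r) ^ 2) r := by
    intro r
    convert! (((hasDerivAt_besselEnergy n (j * r)).comp r
      ((hasDerivAt_id r).const_mul j)).neg).div_const (2 * (n + 1) * j ^ (2 * n + 2)) using 1
    field_simp
    ring
  rw [intervalIntegral.integral_eq_sub_of_hasDerivAt (fun r _ => hd r)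
    (Continuous.intervalIntegrable (by fun_prop) _ _), mul_zero, besselEnergy_zero]
  ring

lemma integrableOn_pow_mul_besselPsi_sq_div {n : ℕ} {j : ℝ} (hj : 0 < j)
    (hz : besselPsi (n + 1) j = 0) (h1 : 0 < besselPsi (n + 2) j) :
    IntegrableOn (fun r => r ^ (2 * n + 1) * (besselPsi (n + 1) (j * r) ^ 2 / (1 - r ^ 2)))
      (Set.Ioi 0) := by
  have hc := continuous_besselPsi (n + 1)
  have hk := continuous_besselKernel (n + 1) j
  rw [← Set.Ioc_union_Ioi_eq_Ioi (zero_le_two (α := ℝ)), integrableOn_union]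
  constructor
  · have hcont : Continuous fun r => r ^ (2 * n + 1) * (besselPsi (n + 1) (j * r) *
        besselKernel (n + 1) j r / (j ^ (2 * (n + 1) + 2) * besselPsi (n + 2) j)) := by
      fun_prop
    refine (hcont.integrableOn_Ioc (a := 0) (b := 2)).congr_fun (fun r hr => ?_) measurableSet_Ioc
    rw [besselPsi_sq_div_eq hj hz h1 hr.1.le]
  · refine Integrable.mono' (g := fun r : ℝ => (j ^ (2 * n + 2))⁻¹ * r ^ (-2 : ℝ))
      ((integrableOn_Ioi_rpow_of_lt (by norm_num) two_pos).const_mul _)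
      (by fun_prop : Measurable _).aestronglyMeasurable ?_
    refine (ae_restrict_iff' measurableSet_Ioi).mpr (.of_forall fun r hr => ?_)
    have hr2 : 2 < r := hr
    have hr0 : 0 < r := by linarith
    have hb := abs_besselJ_le_one (n + 1) (x := j * r) (by positivity)
    rw [← sq_le_one_iff_abs_le_one, besselJ_eq_pow_mul_besselPsi] at hb
    rw [Real.norm_eq_abs, abs_mul, abs_div, abs_of_pos (by positivity : 0 < r ^ (2 * n + 1)),
      abs_of_nonneg (sq_nonneg (besselPsi _ _)), abs_sub_comm,
      abs_of_pos (by nlinarith : 0 < r ^ 2 - 1), Real.rpow_neg hr0.le, Real.rpow_two, mul_div_assoc',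
      div_le_iff₀ (by nlinarith)]
    have e : ((j * r) ^ (n + 1) * besselPsi (n + 1) (j * r)) ^ 2 =
        j ^ (2 * n + 2) * r * (r ^ (2 * n + 1) * besselPsi (n + 1) (j * r) ^ 2) := by
      rw [mul_pow]
      ring
    rw [e, ← le_div_iff₀' (by positivity)] at hb
    refine hb.trans ?_
    rw [← mul_inv, inv_mul_eq_div, div_le_div_iff₀ (by positivity) (by positivity)]
    have : 0 < j ^ (2 * n + 2) := by positivity
    have : j ^ (2 * n + 2) * r * r ≤ j ^ (2 * n + 2) * r * (r ^ 2 - 1) := by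
      gcongr
      nlinarith
    linarith

/-- The radial integral `∫₀^∞ r^{2N-1} ψ(jr)² / (1 - r²) dr`. -/
lemma integral_Ioi_pow_mul_besselPsi_sq_div {n : ℕ} {j : ℝ} (hj : 0 < j)
    (hz : besselPsi (n + 1) j = 0) (h : ∀ t, 0 < t → t < j → 0 < besselPsi (n + 1) t) :
    ∫ r in Set.Ioi (0 : ℝ), r ^ (2 * n + 1) * (besselPsi (n + 1) (j * r) ^ 2 / (1 - r ^ 2)) =
      1 / (2 * (n + 1) * j ^ (2 * n + 2)) := by
  have h1 : 0 < besselPsi (n + 2) j := besselPsi_succ_pos h hj le_rfl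
  have hc := continuous_besselPsi (n + 1)
  have hk := continuous_besselKernel (n + 1) j
  obtain ⟨y, hy, hJ⟩ := exists_seq_tendsto_besselJ (n + 2)
  set x : ℕ → ℝ := fun i => y i / j
  have hxy : ∀ i, j * x i = y i := fun i => by simp only [x]; field_simp
  have hx : Filter.Tendsto x Filter.atTop Filter.atTop := hy.atTop_div_const hj
  have hfint := integrableOn_pow_mul_besselPsi_sq_div hj hz h1
  have hlim := intervalIntegral_tendsto_integral_Ioi 0 hfint hx
  refine tendsto_nhds_unique hlim ?_
  have hE : Filter.Tendsto (fun i => besselEnergy n (y i)) Filter.atTop (nhds 0) := by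
    have : ∀ k ∈ Finset.range (n + 1), Filter.Tendsto
        (fun i => besselJ k (y i) ^ 2 + besselJ (k + 1) (y i) ^ 2) Filter.atTop (nhds 0) := by
      intro k hk
      rw [Finset.mem_range] at hk
      simpa using ((hJ k (by omega)).pow 2).add ((hJ (k + 1) (by omega)).pow 2)
    simpa [besselEnergy] using tendsto_finsetSum _ this
  have hQ := tendsto_integral_pow_mul_besselPsi_sq_div hj hz h hx
    (by simpa only [hxy] using hJ (n + 1) (by omega))
    (by simpa only [hxy] using hJ (n + 2) le_rfl)
  have hsum := (((hE.const_sub 1).div_const (2 * (n + 1) * j ^ (2 * n + 2))).add hQ)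
  rw [sub_zero, add_zero] at hsum
  refine hsum.congr' ?_
  filter_upwards [hx.eventually_ge_atTop 0] with i hi
  rw [← hxy, ← integral_pow_mul_besselPsi_sq n hj, ← intervalIntegral.integral_add
    (Continuous.intervalIntegrable (by fun_prop) _ _)]
  · refine intervalIntegral.integral_congr_ae ?_
    have hae : ∀ᵐ r : ℝ, r ≠ 1 := by simp [ae_iff]
    filter_upwards [hae] with r hne hr
    rw [Set.uIoc_of_le hi] at hr
    have : 1 - r ^ 2 ≠ 0 := by
      rw [sub_ne_zero]
      intro h
      exact hne ((pow_eq_one_iff_of_nonneg hr.1.le two_ne_zero).mp h.symm)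
    field_simp
    ring
  · have hcont : Continuous fun r => r ^ (2 * (n + 1) + 1) * (besselPsi (n + 1) (j * r) *
        besselKernel (n + 1) j r / (j ^ (2 * (n + 1) + 2) * besselPsi (n + 2) j)) := by
      fun_prop
    refine (hcont.intervalIntegrable 0 (x i)).congr fun r hr => ?_
    rw [Set.uIoc_of_le hi] at hr
    rw [besselPsi_sq_div_eq hj hz h1 hr.1.le]

/-! ### The Levenshtein function and its cosine transform -/

lemma integrable_inner_sq_mul_radial {ι : Type*} [Fintype ι] (y : EuclideanSpace ℝ ι) :
    Integrable fun x : EuclideanSpace ℝ ι => ⟪y, x⟫ ^ 2 * max (1 - ‖x‖ ^ 2) 0 := by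
  refine Continuous.integrable_of_hasCompactSupport (by fun_prop) ?_
  refine HasCompactSupport.intro (isCompact_closedBall 0 1) fun x hx => ?_
  have h1 : 1 < ‖x‖ := by simpa using hx
  rw [max_eq_right (by nlinarith), mul_zero]

lemma integral_inner_sq_mul_radial_eq_of_norm_eq {ι : Type*} [Fintype ι]
    {v w : EuclideanSpace ℝ ι} (h : ‖v‖ = ‖w‖) (m : ℝ → ℝ) :
    ∫ x : EuclideanSpace ℝ ι, ⟪v, x⟫ ^ 2 * m ‖x‖ =
      ∫ x : EuclideanSpace ℝ ι, ⟪w, x⟫ ^ 2 * m ‖x‖ := by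
  let R := (ℝ ∙ (v - w))ᗮ.reflection
  have hR : R v = w := Submodule.reflection_sub h
  rw [← (R.measurePreserving).integral_comp R.toHomeomorph.measurableEmbedding
    (fun x => ⟪w, x⟫ ^ 2 * m ‖x‖)]
  refine integral_congr_ae (.of_forall fun x => ?_)
  simp only [← hR, LinearIsometryEquiv.inner_map_map, LinearIsometryEquiv.norm_map]

lemma card_mul_integral_inner_sq_mul_radial {ι : Type*} [Fintype ι] (y : EuclideanSpace ℝ ι) :
    Fintype.card ι * ∫ x : EuclideanSpace ℝ ι, ⟪y, x⟫ ^ 2 * max (1 - ‖x‖ ^ 2) 0 =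
      ‖y‖ ^ 2 * ∫ x : EuclideanSpace ℝ ι, ‖x‖ ^ 2 * max (1 - ‖x‖ ^ 2) 0 := by
  classical
  let e (i : ι) : EuclideanSpace ℝ ι := EuclideanSpace.single i ‖y‖
  have he (i : ι) : ‖y‖ = ‖e i‖ := by simp [e]
  calc (Fintype.card ι : ℝ) * ∫ x : EuclideanSpace ℝ ι, ⟪y, x⟫ ^ 2 * max (1 - ‖x‖ ^ 2) 0
      = ∑ i : ι, ∫ x : EuclideanSpace ℝ ι, ⟪e i, x⟫ ^ 2 * max (1 - ‖x‖ ^ 2) 0 := by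
        rw [Finset.sum_congr rfl fun i _ => (integral_inner_sq_mul_radial_eq_of_norm_eq (he i)
          fun r => max (1 - r ^ 2) 0).symm]
        simp
    _ = ∫ x : EuclideanSpace ℝ ι, ∑ i : ι, ⟪e i, x⟫ ^ 2 * max (1 - ‖x‖ ^ 2) 0 :=
        (integral_finsetSum _ fun i _ => integrable_inner_sq_mul_radial (e i)).symm
    _ = ∫ x : EuclideanSpace ℝ ι, ‖y‖ ^ 2 * (‖x‖ ^ 2 * max (1 - ‖x‖ ^ 2) 0) := by
        refine integral_congr_ae (.of_forall fun x => ?_)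
        simp only [e, EuclideanSpace.inner_single_left, EuclideanSpace.real_norm_sq_eq x,
          ← Finset.sum_mul, mul_pow, ← Finset.mul_sum]
        simp [mul_assoc]
    _ = _ := integral_const_mul _ _

lemma integral_Ioi_pow_mul_radial (n : ℕ) :
    ∫ r in Set.Ioi (0 : ℝ), r ^ (2 * n + 1) * (r ^ 2 * max (1 - r ^ 2) 0) =
      1 / (2 * ((n : ℝ) + 2) * (n + 3)) := by
  have hsub : Set.Ioc (0 : ℝ) 1 ⊆ Set.Ioi 0 := fun r hr => hr.1
  rw [setIntegral_eq_of_subset_of_forall_sdiff_eq_zero measurableSet_Ioi hsub,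
    ← intervalIntegral.integral_of_le zero_le_one]
  · have h : ∀ r ∈ Set.uIcc (0 : ℝ) 1,
        r ^ (2 * n + 1) * (r ^ 2 * max (1 - r ^ 2) 0) = r ^ (2 * n + 3) - r ^ (2 * n + 5) := by
      intro r hr
      rw [Set.uIcc_of_le zero_le_one] at hr
      rw [max_eq_left (by nlinarith [hr.1, hr.2])]
      ring
    rw [intervalIntegral.integral_congr h, intervalIntegral.integral_sub (by simp) (by simp)]
    simp only [integral_pow]
    push_cast
    field_simp
    simp
    ring
  · rintro r ⟨hr0, hr1⟩
    have : 1 < r := by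
      by_contra! hcon
      exact hr1 ⟨hr0, hcon⟩
    rw [max_eq_right (by nlinarith)]
    simp

lemma integral_inner_sq_mul_radial (n : ℕ) (y : EuclideanSpace ℝ (Fin (2 * (n + 1)))) :
    ∫ x : EuclideanSpace ℝ (Fin (2 * (n + 1))), ⟪y, x⟫ ^ 2 * max (1 - ‖x‖ ^ 2) 0 =
      ‖y‖ ^ 2 * volume.real (Metric.ball (0 : EuclideanSpace ℝ (Fin (2 * (n + 1)))) 1) /
        (2 * (n + 2) * (n + 3)) := by
  have h := card_mul_integral_inner_sq_mul_radial y
  rw [integral_fun_norm_addHaar volume (fun r : ℝ => r ^ 2 * max (1 - r ^ 2) 0),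
    finrank_euclideanSpace_fin, show 2 * (n + 1) - 1 = 2 * n + 1 by omega] at h
  simp only [smul_eq_mul, nsmul_eq_mul, integral_Ioi_pow_mul_radial, Fintype.card_fin] at h
  have hn : ((2 * (n + 1) : ℕ) : ℝ) ≠ 0 := by positivity
  refine mul_left_cancel₀ hn (h.trans ?_)
  ring

lemma levenshteinF_eq (N : ℕ) (j : ℝ) (x : EuclideanSpace ℝ (Fin (2 * N))) :
    levenshteinF N j x =
      (N.factorial : ℝ) ^ 2 * 4 ^ N * (besselPsi N (j * ‖x‖) ^ 2 / (1 - ‖x‖ ^ 2)) := by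
  unfold levenshteinF
  split_ifs with h
  · simp [h]
  · ring

lemma levenshteinF_zero (N : ℕ) (j : ℝ) : levenshteinF N j 0 = 1 := by
  rw [levenshteinF_eq, norm_zero, mul_zero, besselPsi_zero, show (4 : ℝ) = 2 ^ 2 by norm_num]
  field_simp
  simp [← pow_mul, mul_comm]

lemma levenshteinF_nonpos {N : ℕ} (j : ℝ) {x : EuclideanSpace ℝ (Fin (2 * N))} (hx : 1 ≤ ‖x‖) :
    levenshteinF N j x ≤ 0 := by
  rw [levenshteinF_eq]
  exact mul_nonpos_of_nonneg_of_nonpos (by positivity)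
    (div_nonpos_of_nonneg_of_nonpos (sq_nonneg _) (by nlinarith))

lemma levenshteinF_le {N : ℕ} {j : ℝ} (hj : 0 < j) (hz : besselPsi N j = 0)
    (h : ∀ t, 0 < t → t < j → 0 < besselPsi N t) (x : EuclideanSpace ℝ (Fin (2 * N))) :
    levenshteinF N j x ≤ max (1 - ‖x‖ ^ 2) 0 := by
  obtain hx | hx := le_or_gt 1 ‖x‖
  · exact (levenshteinF_nonpos j hx).trans (le_max_right _ _)
  refine le_max_of_le_left ?_
  have hx0 := norm_nonneg x
  have hpos : 0 < 1 - ‖x‖ ^ 2 := by nlinarith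
  have hle := besselPsi_le_parabola hj hz h (t := j * ‖x‖) (by positivity) (by nlinarith)
  rw [mul_div_cancel_left₀ _ hj.ne', besselPsi_zero] at hle
  have h0 : 0 ≤ besselPsi N (j * ‖x‖) := by
    obtain h' | h' := hx0.eq_or_lt
    · rw [← h', mul_zero, besselPsi_zero]
      positivity
    · exact (h _ (by positivity) (by nlinarith)).le
  rw [levenshteinF_eq, ← mul_div_assoc, div_le_iff₀ hpos]
  calc (N.factorial : ℝ) ^ 2 * 4 ^ N * besselPsi N (j * ‖x‖) ^ 2
      ≤ (N.factorial : ℝ) ^ 2 * 4 ^ N * (1 / (2 ^ N * N.factorial) * (1 - ‖x‖ ^ 2)) ^ 2 := by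
        gcongr
    _ = (1 - ‖x‖ ^ 2) * (1 - ‖x‖ ^ 2) := by
        rw [show (4 : ℝ) ^ N = (2 ^ N) ^ 2 by rw [← pow_mul, mul_comm, pow_mul]; norm_num]
        field_simp

lemma integrable_levenshteinF {n : ℕ} {j : ℝ} (hj : 0 < j) (hz : besselPsi (n + 1) j = 0)
    (h1 : 0 < besselPsi (n + 2) j) : Integrable (levenshteinF (n + 1) j) := by
  rw [show levenshteinF (n + 1) j = _ from funext fun x => levenshteinF_eq (n + 1) j x]
  refine Integrable.const_mul ?_ _
  refine (integrable_fun_norm_addHaar volume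
    (f := fun r => besselPsi (n + 1) (j * r) ^ 2 / (1 - r ^ 2))).mpr ?_
  rw [finrank_euclideanSpace_fin, show 2 * (n + 1) - 1 = 2 * n + 1 by omega]
  exact integrableOn_pow_mul_besselPsi_sq_div hj hz h1

lemma integral_levenshteinF {n : ℕ} {j : ℝ} (hj : 0 < j) (hz : besselPsi (n + 1) j = 0)
    (h : ∀ t, 0 < t → t < j → 0 < besselPsi (n + 1) t) :
    ∫ x, levenshteinF (n + 1) j x =
      volume.real (Metric.ball (0 : EuclideanSpace ℝ (Fin (2 * (n + 1)))) 1) *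
        ((n + 1).factorial ^ 2 * 4 ^ (n + 1)) / j ^ (2 * n + 2) := by
  simp only [levenshteinF_eq, integral_const_mul]
  rw [integral_fun_norm_addHaar volume (fun r => besselPsi (n + 1) (j * r) ^ 2 / (1 - r ^ 2)),
    finrank_euclideanSpace_fin, show 2 * (n + 1) - 1 = 2 * n + 1 by omega]
  simp only [smul_eq_mul, nsmul_eq_mul, integral_Ioi_pow_mul_besselPsi_sq_div hj hz h]
  push_cast
  field_simp

lemma integrable_cos_inner_mul {N : ℕ} {f : EuclideanSpace ℝ (Fin (2 * N)) → ℝ}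
    (hf : Integrable f) (y : EuclideanSpace ℝ (Fin (2 * N))) :
    Integrable fun x => cos ⟪y, x⟫ * f x := by
  refine hf.bdd_mul (c := 1) (Continuous.aestronglyMeasurable (by fun_prop)) (.of_forall fun x => ?_)
  simpa using abs_cos_le_one _

lemma le_integral_cos_inner_mul_levenshteinF {n : ℕ} {j : ℝ} (hj : 0 < j)
    (hz : besselPsi (n + 1) j = 0) (h : ∀ t, 0 < t → t < j → 0 < besselPsi (n + 1) t)
    (y : EuclideanSpace ℝ (Fin (2 * (n + 1)))) :
    (∫ x, levenshteinF (n + 1) j x) -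
      ‖y‖ ^ 2 * volume.real (Metric.ball (0 : EuclideanSpace ℝ (Fin (2 * (n + 1)))) 1) /
        (4 * (n + 2) * (n + 3)) ≤ ∫ x, cos ⟪y, x⟫ * levenshteinF (n + 1) j x := by
  have hfint := integrable_levenshteinF hj hz (besselPsi_succ_pos h hj le_rfl)
  have key : (∫ x, levenshteinF (n + 1) j x) - ∫ x, cos ⟪y, x⟫ * levenshteinF (n + 1) j x ≤
      ∫ x : EuclideanSpace ℝ (Fin (2 * (n + 1))), 1 / 2 * (⟪y, x⟫ ^ 2 * max (1 - ‖x‖ ^ 2) 0) := by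
    rw [← integral_sub hfint (integrable_cos_inner_mul hfint y)]
    refine integral_mono (hfint.sub (integrable_cos_inner_mul hfint y))
      ((integrable_inner_sq_mul_radial y).const_mul _) fun x => ?_
    have hcos := one_sub_sq_div_two_le_cos (x := ⟪y, x⟫)
    have hle := levenshteinF_le hj hz h x
    have hmax := le_max_right (1 - ‖x‖ ^ 2) 0
    calc levenshteinF (n + 1) j x - cos ⟪y, x⟫ * levenshteinF (n + 1) j x
        = (1 - cos ⟪y, x⟫) * levenshteinF (n + 1) j x := by ring
      _ ≤ (1 - cos ⟪y, x⟫) * max (1 - ‖x‖ ^ 2) 0 :=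
          mul_le_mul_of_nonneg_left hle (sub_nonneg.2 (cos_le_one _))
      _ ≤ ⟪y, x⟫ ^ 2 / 2 * max (1 - ‖x‖ ^ 2) 0 :=
          mul_le_mul_of_nonneg_right (by linarith) hmax
      _ = _ := by ring
  rw [integral_const_mul, integral_inner_sq_mul_radial] at key
  have : 1 / 2 * (‖y‖ ^ 2 *
      volume.real (Metric.ball (0 : EuclideanSpace ℝ (Fin (2 * (n + 1)))) 1) /
        (2 * (n + 2) * (n + 3))) = ‖y‖ ^ 2 *
      volume.real (Metric.ball (0 : EuclideanSpace ℝ (Fin (2 * (n + 1)))) 1) /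
        (4 * (n + 2) * (n + 3)) := by
    field_simp
    ring
  linarith

/-! ### The numerical estimate on the range of `d` -/

lemma pow_ratio_le (n : ℕ) :
    (((n : ℝ) + 3) * (n + 5)) ^ (2 * n + 4) ≤ 55 * (((n : ℝ) + 2) * (n + 4)) ^ (2 * n + 4) := by
  have hexp : exp 4 ≤ 55 := by
    rw [show (4 : ℝ) = (4 : ℕ) * 1 by norm_num, exp_nat_mul]
    calc exp 1 ^ 4 ≤ 2.7182818286 ^ 4 := by gcongr; exact exp_one_lt_d9.le
      _ ≤ 55 := by norm_num
  have hbase : ((n : ℝ) + 3) * (n + 5) ≤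
      exp ((2 * n + 7) / ((n + 2) * (n + 4))) * ((n + 2) * (n + 4)) := by
    have := add_one_le_exp ((2 * (n : ℝ) + 7) / ((n + 2) * (n + 4)))
    refine le_trans (le_of_eq ?_) (mul_le_mul_of_nonneg_right this (by positivity))
    field_simp
    ring
  calc (((n : ℝ) + 3) * (n + 5)) ^ (2 * n + 4)
      ≤ (exp ((2 * n + 7) / ((n + 2) * (n + 4))) * ((n + 2) * (n + 4))) ^ (2 * n + 4) := by gcongr
    _ = exp ((2 * n + 4 : ℕ) * ((2 * n + 7) / ((n + 2) * (n + 4)))) *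
          (((n : ℝ) + 2) * (n + 4)) ^ (2 * n + 4) := by rw [mul_pow, exp_nat_mul]
    _ ≤ 55 * (((n : ℝ) + 2) * (n + 4)) ^ (2 * n + 4) := by
        gcongr
        refine le_trans (exp_le_exp.2 ?_) hexp
        rw [mul_div_assoc', div_le_iff₀ (by positivity)]
        push_cast
        nlinarith

lemma gamma_nat_succ_add_half (n : ℕ) :
    Gamma ((n + 1 : ℕ) + 1 / 2) = (n + 1 / 2) * Gamma (n + 1 / 2) := by
  rw [← Gamma_add_one (by positivity)]
  push_cast
  ring_nf

lemma gamma_two_add_half_sq : Gamma ((2 : ℕ) + 1 / 2) ^ 2 = 9 / 16 * π := by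
  have h1 := gamma_nat_succ_add_half 1
  have h0 := gamma_nat_succ_add_half 0
  norm_num [Gamma_one_half_eq] at h1 h0
  norm_num [h1, h0, mul_pow, sq_sqrt pi_pos.le]
  ring

lemma pow_le_gamma_sq_mul_of_two_le {n : ℕ} (hn : 2 ≤ n) :
    128 * (((n : ℝ) + 2) * (n + 4)) ^ (2 * n + 4) ≤
      9 * π * Gamma (n + 1 / 2) ^ 2 * (n + 1).factorial ^ 4 * 16 ^ (n + 2) *
        ((n + 2) * (n + 3)) ^ 3 := by
  induction n, hn using Nat.le_induction with
  | base =>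
    rw [gamma_two_add_half_sq]
    have := pi_gt_d2
    norm_num [Nat.factorial]
    nlinarith
  | succ n hn ih =>
    have hpoly : 55 * (((n : ℝ) + 3) * (n + 5)) ^ 2 ≤
        16 * (n + 1 / 2) ^ 2 * (n + 2) * (n + 4) ^ 3 := by
      obtain ⟨k, rfl⟩ := Nat.exists_eq_add_of_le hn
      push_cast
      have : (0 : ℝ) ≤ k := by positivity
      rw [← sub_nonneg]
      ring_nf
      positivity
    rw [gamma_nat_succ_add_half, Nat.factorial_succ (n + 1)]
    push_cast
    calc 128 * (((n : ℝ) + 1 + 2) * (n + 1 + 4)) ^ (2 * (n + 1) + 4)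
        = 128 * (((n : ℝ) + 3) * (n + 5)) ^ 2 * (((n : ℝ) + 3) * (n + 5)) ^ (2 * n + 4) := by ring
      _ ≤ 128 * (((n : ℝ) + 3) * (n + 5)) ^ 2 *
            (55 * (((n : ℝ) + 2) * (n + 4)) ^ (2 * n + 4)) := by
          gcongr ?_ * ?_
          exact pow_ratio_le n
      _ = 55 * (((n : ℝ) + 3) * (n + 5)) ^ 2 *
            (128 * (((n : ℝ) + 2) * (n + 4)) ^ (2 * n + 4)) := by ring
      _ ≤ 16 * ((n : ℝ) + 1 / 2) ^ 2 * (n + 2) * (n + 4) ^ 3 *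
            (9 * π * Gamma (n + 1 / 2) ^ 2 * (n + 1).factorial ^ 4 * 16 ^ (n + 2) *
              ((n + 2) * (n + 3)) ^ 3) := by
          gcongr
      _ = _ := by ring

lemma besselJ_sq_mul_pow_le_gamma_sq_mul (n : ℕ) {x : ℝ} (hx : 0 ≤ x) :
    256 * besselJ n x ^ 2 * (((n : ℝ) + 2) * (n + 4)) ^ (2 * n + 4) ≤
      9 * π * Gamma (n + 1 / 2) ^ 2 * (n + 1).factorial ^ 4 * 16 ^ (n + 2) *
        ((n + 2) * (n + 3)) ^ 3 := by
  have hpi := pi_gt_d2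
  match n with
  | 0 =>
    have hJ : besselJ 0 x ^ 2 ≤ 1 := (sq_le_one_iff_abs_le_one _).2 (abs_besselJ_le_one 0 hx)
    norm_num [Gamma_one_half_eq, sq_sqrt pi_pos.le]
    nlinarith
  | m + 1 =>
    have hJ := besselJ_succ_sq_le_half m hx
    have hle : 256 * besselJ (m + 1) x ^ 2 *
        ((((m + 1 : ℕ) : ℝ) + 2) * ((m + 1 : ℕ) + 4)) ^ (2 * (m + 1) + 4) ≤
        128 * ((((m + 1 : ℕ) : ℝ) + 2) * ((m + 1 : ℕ) + 4)) ^ (2 * (m + 1) + 4) := by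
      gcongr
      linarith
    refine hle.trans ?_
    obtain rfl | hm := Nat.eq_zero_or_pos m
    · rw [gamma_nat_succ_add_half]
      norm_num [Gamma_one_half_eq, mul_pow, sq_sqrt pi_pos.le, Nat.factorial]
      nlinarith
    · exact pow_le_gamma_sq_mul_of_two_le (by omega)

lemma pow_four_mul_pow_le {n : ℕ} {j d : ℝ} (hj : 0 < j) (hd : 0 < d)
    (hjsq : j ^ 2 ≤ 2 * ((n : ℝ) + 2) * (n + 4))
    (hd_plus : d ≤ (16 * ((n + 1).factorial : ℝ) * |besselJ n j| /
      (3 * √π * Gamma (n + 1 / 2) * j ^ ((n : ℝ) - 1))) ^ ((1 : ℝ) / 6)) :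
    d ^ 4 * j ^ (2 * n + 2) ≤ (n + 1).factorial ^ 2 * 4 ^ (n + 2) * (n + 2) * (n + 3) := by
  have hG : 0 < Gamma ((n : ℝ) + 1 / 2) := Gamma_pos_of_pos (by positivity)
  set D : ℝ := 16 * ((n + 1).factorial : ℝ) * |besselJ n j| /
      (3 * √π * Gamma (n + 1 / 2) * j ^ ((n : ℝ) - 1)) with hD
  have hD0 : 0 ≤ D := by positivity
  have hd6 : d ^ 6 ≤ D := by
    calc d ^ 6 ≤ (D ^ ((1 : ℝ) / 6)) ^ 6 := by gcongr
      _ = D := by rw [← rpow_natCast, ← rpow_mul hD0]; norm_num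
  have hDsq : D ^ 2 * j ^ (6 * n + 6) * (9 * π * Gamma (n + 1 / 2) ^ 2) =
      256 * (n + 1).factorial ^ 2 * besselJ n j ^ 2 * (j ^ 2) ^ (2 * n + 4) := by
    rw [hD, rpow_sub hj, rpow_natCast, rpow_one, div_pow, mul_pow _ |besselJ n j|, sq_abs, mul_pow,
      mul_pow, mul_pow, mul_pow 3, sq_sqrt pi_pos.le]
    field_simp
    ring
  refine (pow_le_pow_iff_left₀ (by positivity) (by positivity) three_ne_zero).1 ?_
  refine le_of_mul_le_mul_right ?_ (show 0 < 9 * π * Gamma ((n : ℝ) + 1 / 2) ^ 2 by positivity)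
  calc (d ^ 4 * j ^ (2 * n + 2)) ^ 3 * (9 * π * Gamma (n + 1 / 2) ^ 2)
      = (d ^ 6) ^ 2 * j ^ (6 * n + 6) * (9 * π * Gamma (n + 1 / 2) ^ 2) := by ring
    _ ≤ D ^ 2 * j ^ (6 * n + 6) * (9 * π * Gamma (n + 1 / 2) ^ 2) := by gcongr
    _ = 256 * (n + 1).factorial ^ 2 * besselJ n j ^ 2 * (j ^ 2) ^ (2 * n + 4) := hDsq
    _ ≤ 256 * (n + 1).factorial ^ 2 * besselJ n j ^ 2 *
          (2 * ((n : ℝ) + 2) * (n + 4)) ^ (2 * n + 4) := by gcongr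
    _ = (n + 1).factorial ^ 2 * 2 ^ (2 * n + 4) * (256 * besselJ n j ^ 2 *
          (((n : ℝ) + 2) * (n + 4)) ^ (2 * n + 4)) := by
        rw [mul_assoc 2, mul_pow]
        ring
    _ ≤ (n + 1).factorial ^ 2 * 2 ^ (2 * n + 4) * (9 * π * Gamma (n + 1 / 2) ^ 2 *
          (n + 1).factorial ^ 4 * 16 ^ (n + 2) * ((n + 2) * (n + 3)) ^ 3) := by
        gcongr ?_ * ?_
        exact besselJ_sq_mul_pow_le_gamma_sq_mul n hj.le
    _ = _ := by
        rw [show (2 : ℝ) ^ (2 * n + 4) = 4 ^ (n + 2) by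
            rw [show 2 * n + 4 = 2 * (n + 2) by ring, pow_mul]; norm_num,
          show (16 : ℝ) ^ (n + 2) = (4 ^ (n + 2)) ^ 2 by rw [← pow_mul, mul_comm, pow_mul]; norm_num]
        ring

/-- Lemma 2 (Levenshtein supremum): for `0 < d ≤ d₊` and `‖v‖ ≤ d`,
`f(v/d)·f̂(0) ≤ f(0)·f̂(d·v)`, i.e. the supremum of `f(x/d)/f̂(dx)` over `[0,d]`
is attained at the origin and equals `f(0)/f̂(0)`. -/
theorem levenshtein_supremum (N : ℕ) (hN : 1 ≤ N) (j : ℝ) (hj : 0 < j)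
    (hjz : besselJ N j = 0) (hj_first : ∀ t : ℝ, 0 < t → t < j → besselJ N t ≠ 0)
    (d : ℝ) (hd : 0 < d)
    (hd_plus : d ≤ (16 * (N.factorial : ℝ) * |besselJ (N - 1) j| /
      (3 * Real.sqrt π * Real.Gamma ((2 * (N : ℝ) - 1) / 2) * j ^ ((N : ℝ) - 2))) ^ ((1 : ℝ) / 6))
    (v : EuclideanSpace ℝ (Fin (2 * N))) (hv : ‖v‖ ≤ d) :
    levenshteinF N j (d⁻¹ • v) * fourierCos N (levenshteinF N j) 0 ≤
      levenshteinF N j 0 * fourierCos N (levenshteinF N j) (d • v) := by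
  obtain ⟨n, rfl⟩ : ∃ n, N = n + 1 := ⟨N - 1, by omega⟩
  have hz : besselPsi (n + 1) j = 0 := by
    rw [besselJ_eq_pow_mul_besselPsi] at hjz
    exact (mul_eq_zero.1 hjz).resolve_left (by positivity)
  have hpos : ∀ t, 0 < t → t < j → 0 < besselPsi (n + 1) t :=
    fun t ht htj => besselPsi_pos_of_lt hj_first ht.le htj
  have hjsq : j ^ 2 ≤ 2 * ((n : ℝ) + 2) * (n + 4) := by
    refine (sq_le_of_besselPsi_eq_zero hj hz hpos).trans_eq ?_
    push_cast
    ring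
  have hnum : d ^ 4 * j ^ (2 * n + 2) ≤
      (n + 1).factorial ^ 2 * 4 ^ (n + 2) * (n + 2) * (n + 3) := by
    refine pow_four_mul_pow_le hj hd hjsq (hd_plus.trans_eq ?_)
    rw [show (2 * ((n + 1 : ℕ) : ℝ) - 1) / 2 = n + 1 / 2 by push_cast; ring,
      show (((n + 1 : ℕ) : ℝ) - 2) = n - 1 by push_cast; ring, Nat.add_sub_cancel]
  set V := volume.real (Metric.ball (0 : EuclideanSpace ℝ (Fin (2 * (n + 1)))) 1) with hV
  have hV0 : 0 ≤ V := measureReal_nonneg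
  have hI := integral_levenshteinF hj hz hpos
  have hcos := le_integral_cos_inner_mul_levenshteinF hj hz hpos (d • v)
  have hs1 : ‖d⁻¹ • v‖ ≤ 1 := by
    rw [norm_smul, norm_inv, norm_of_nonneg hd.le, inv_mul_le_iff₀ hd, mul_one]
    exact hv
  have hnorm : ‖d • v‖ ^ 2 = d ^ 4 * ‖d⁻¹ • v‖ ^ 2 := by
    rw [norm_smul, norm_smul, norm_inv, norm_of_nonneg hd.le]
    field_simp
  have hle := levenshteinF_le hj hz hpos (d⁻¹ • v)
  rw [max_eq_left (by nlinarith [norm_nonneg (d⁻¹ • v)])] at hle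
  rw [levenshteinF_zero, one_mul, fourierCos, fourierCos, mul_left_comm]
  refine mul_le_mul_of_nonneg_left ?_ (by positivity)
  simp only [inner_zero_left, cos_zero, one_mul]
  rw [← hV, hnorm] at hcos
  rw [← hV] at hI
  have hI0 : 0 ≤ ∫ x, levenshteinF (n + 1) j x := by
    rw [hI]
    positivity
  have hbound : d ^ 4 * V / (4 * (n + 2) * (n + 3)) ≤ ∫ x, levenshteinF (n + 1) j x := by
    rw [hI, div_le_div_iff₀ (by positivity) (by positivity)]
    calc d ^ 4 * V * j ^ (2 * n + 2) = V * (d ^ 4 * j ^ (2 * n + 2)) := by ring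
      _ ≤ V * ((n + 1).factorial ^ 2 * 4 ^ (n + 2) * (n + 2) * (n + 3)) := by gcongr
      _ = _ := by ring
  calc levenshteinF (n + 1) j (d⁻¹ • v) * ∫ x, levenshteinF (n + 1) j x
      ≤ (1 - ‖d⁻¹ • v‖ ^ 2) * ∫ x, levenshteinF (n + 1) j x :=
        mul_le_mul_of_nonneg_right hle hI0
    _ = (∫ x, levenshteinF (n + 1) j x) - ‖d⁻¹ • v‖ ^ 2 * ∫ x, levenshteinF (n + 1) j x := by ring
    _ ≤ (∫ x, levenshteinF (n + 1) j x) -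
          ‖d⁻¹ • v‖ ^ 2 * (d ^ 4 * V / (4 * (n + 2) * (n + 3))) := by gcongr
    _ = (∫ x, levenshteinF (n + 1) j x) -
          d ^ 4 * ‖d⁻¹ • v‖ ^ 2 * V / (4 * (n + 2) * (n + 3)) := by ring
    _ ≤ _ := hcos
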